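/- Let n be a natural number, let F, H : ℝ → Matrix (Fin n) (Fin n) ℂ be (continuous) matrix-valued functions, and let K₁, K₂, K₃ be n×n diagonal matrices with real diagonal entries such that the diagonal entries of K₁ are positive. Suppose e, eA, eB : ℝ → ℂⁿ are differentiable and satisfy for all t: e′(t) = F(t)·eA(t) + H(t)·eB(t) − K₁·e(t) − K₂·eA(t) − K₃·eB(t), eA′(t) = −(F(t))ᴴ·e(t) + K₂·e(t), eB′(t) = −(H(t))ᴴ·e(t) + K₃·e(t). Then the Lyapunov function V(t) = ½(‖e(t)‖² + ‖eA(t)‖² + ‖eB(t)‖²) is nonincreasing in t. -/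

import Mathlib

open Matrix

/-- Matrix–vector multiplication on the Euclidean space `ℂⁿ`. -/
noncomputable def mulVecE {n : ℕ} (M : Matrix (Fin n) (Fin n) ℂ)
    (v : EuclideanSpace ℂ (Fin n)) : EuclideanSpace ℂ (Fin n) :=
  Matrix.toEuclideanLin M v

theorem EuclideanSpace.real_inner_eq_re_inner_complex {ι : Type*} [Fintype ι]
    (u v : EuclideanSpace ℂ ι) : inner ℝ u v = (inner ℂ u v).re := by
  rw [PiLp.inner_apply, PiLp.inner_apply, Complex.re_sum]
  rfl

theorem re_inner_mulVecE_comm {n : ℕ} (M : Matrix (Fin n) (Fin n) ℂ)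
    (u v : EuclideanSpace ℂ (Fin n)) :
    (inner ℂ u (mulVecE M v)).re = (inner ℂ v (mulVecE Mᴴ u)).re := by
  unfold mulVecE
  rw [Matrix.toEuclideanLin_conjTranspose_eq_adjoint, LinearMap.adjoint_inner_right,
    ← inner_conj_symm, Complex.conj_re]

theorem conjTranspose_diagonal_ofReal {n : ℕ} (k : Fin n → ℝ) :
    (Matrix.diagonal fun i => (k i : ℂ))ᴴ = Matrix.diagonal fun i => (k i : ℂ) := by
  rw [Matrix.diagonal_conjTranspose]
  congr 1
  ext i
  simp

theorem re_inner_mulVecE_diagonal_nonneg {n : ℕ} {k : Fin n → ℝ} (hk : ∀ i, 0 ≤ k i)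
    (v : EuclideanSpace ℂ (Fin n)) :
    0 ≤ (inner ℂ v (mulVecE (Matrix.diagonal fun i => (k i : ℂ)) v)).re := by
  rw [PiLp.inner_apply, Complex.re_sum]
  refine Finset.sum_nonneg fun i _ => ?_
  have h : (inner ℂ (v i) (mulVecE (Matrix.diagonal fun i => (k i : ℂ)) v i)).re
      = k i * ((v i).re ^ 2 + (v i).im ^ 2) := by
    simp [mulVecE, Matrix.toLpLin_apply, Matrix.mulVec_diagonal]
    ring
  rw [h]
  exact mul_nonneg (hk i) (by positivity)

/-- Along solutions of the controlled error dynamics with the adaptive parameter-update laws,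
the Lyapunov function `V(t) = ½(‖e(t)‖² + ‖eA(t)‖² + ‖eB(t)‖²)` is nonincreasing. -/
theorem adaptive_sync_lyapunov_nonincreasing (n : ℕ)
    (F H : ℝ → Matrix (Fin n) (Fin n) ℂ) (hF : Continuous F) (hH : Continuous H)
    (k₁ k₂ k₃ : Fin n → ℝ) (hk₁ : ∀ i, 0 < k₁ i)
    (K₁ K₂ K₃ : Matrix (Fin n) (Fin n) ℂ)
    (hK₁ : K₁ = Matrix.diagonal fun i => (k₁ i : ℂ))
    (hK₂ : K₂ = Matrix.diagonal fun i => (k₂ i : ℂ))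
    (hK₃ : K₃ = Matrix.diagonal fun i => (k₃ i : ℂ))
    (e eA eB : ℝ → EuclideanSpace ℂ (Fin n))
    (hde : ∀ t, HasDerivAt e
      (mulVecE (F t) (eA t) + mulVecE (H t) (eB t)
        - mulVecE K₁ (e t) - mulVecE K₂ (eA t) - mulVecE K₃ (eB t)) t)
    (hdeA : ∀ t, HasDerivAt eA (-(mulVecE (F t)ᴴ (e t)) + mulVecE K₂ (e t)) t)
    (hdeB : ∀ t, HasDerivAt eB (-(mulVecE (H t)ᴴ (e t)) + mulVecE K₃ (e t)) t) :
    Antitone (fun t => (1 / 2 : ℝ) * (‖e t‖ ^ 2 + ‖eA t‖ ^ 2 + ‖eB t‖ ^ 2)) := by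
  subst hK₁ hK₂ hK₃
  have hV := fun t => (((hde t).norm_sq.add (hdeA t).norm_sq).add (hdeB t).norm_sq).const_mul
    (1 / 2 : ℝ)
  refine antitone_of_hasDerivAt_nonpos hV fun t => ?_
  have hA := re_inner_mulVecE_comm (F t) (e t) (eA t)
  have hB := re_inner_mulVecE_comm (H t) (e t) (eB t)
  have h₂ := re_inner_mulVecE_comm (Matrix.diagonal fun i => (k₂ i : ℂ)) (e t) (eA t)
  have h₃ := re_inner_mulVecE_comm (Matrix.diagonal fun i => (k₃ i : ℂ)) (e t) (eB t)
  rw [conjTranspose_diagonal_ofReal] at h₂ h₃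
  have h₁ := re_inner_mulVecE_diagonal_nonneg (fun i => (hk₁ i).le) (e t)
  simp only [inner_add_right, inner_sub_right, inner_neg_right,
    EuclideanSpace.real_inner_eq_re_inner_complex, Pi.zero_apply]
  linarith
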